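/- Under the hypotheses J > 0, 0 ≤ ν < 1, K_I > 0, K_p > (1−ν)·L/J, and |T_a(ω_c + e) − T_a(ω_c)| ≤ L·|e| for all e, the set {(x, e) : dV/dt(x, e) = 0} for the shifted Region 2 error dynamics is contained in the set {(x, e) : e = 0}, and the only trajectory of the dynamics remaining in {e = 0} for all time is the equilibrium (x, e) = (0, 0). -/

import Mathlib

/-- For the shifted Region 2 error dynamics, the set where dV/dt vanishes is
contained in {e = 0}, and the only trajectory remaining in {e = 0} for all
time is the equilibrium (x, e) = (0, 0). -/
theorem stmt_3 (J ν K_I K_p L ωc : ℝ) (T_a : ℝ → ℝ)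
    (hJ : 0 < J) (hν0 : 0 ≤ ν) (hν1 : ν < 1) (hKI : 0 < K_I) (hL : 0 ≤ L)
    (hLip : ∀ e : ℝ, |T_a (ωc + e) - T_a ωc| ≤ L * |e|)
    (hKp : K_p > (1 - ν) * L / J) :
    let f : ℝ → ℝ → ℝ := fun x e =>
      (1 / J) * (T_a (ωc + e) - T_a ωc) - (1 / (1 - ν)) * (K_I * x + K_p * e)
    let dVdt : ℝ → ℝ → ℝ := fun x e => e * f x e + (K_I / (1 - ν)) * x * e
    -- (1) dV/dt = 0 only where e = 0
    ({ p : ℝ × ℝ | dVdt p.1 p.2 = 0 } ⊆ { p : ℝ × ℝ | p.2 = 0 }) ∧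
    -- (2) any solution trajectory that stays in {e = 0} is the origin
    (∀ x e : ℝ → ℝ,
      (∀ t : ℝ, HasDerivAt x (e t) t) →
      (∀ t : ℝ, HasDerivAt e (f (x t) (e t)) t) →
      (∀ t : ℝ, e t = 0) →
      ∀ t : ℝ, x t = 0 ∧ e t = 0) := by
  intro f dVdt
  have hn : 0 < 1 - ν := by linarith
  refine ⟨?_, ?_⟩
  · rintro ⟨x, e⟩ h
    simp only [Set.mem_setOf_eq] at h ⊢
    by_contra he
    have h1 : (1 - ν) * (e * (T_a (ωc + e) - T_a ωc)) = J * K_p * e ^ 2 := by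
      simp only [dVdt, f] at h
      field_simp at h
      have h' : (1 - ν) * (T_a (ωc + e) - T_a ωc) = J * K_p * e := by
        rcases mul_eq_zero.mp (show e * ((1 - ν) * (T_a (ωc + e) - T_a ωc) - J * K_p * e) = 0 by
          linarith) with h0 | h0
        · exact absurd h0 he
        · linarith
      linear_combination e * h'
    have h2 : e * (T_a (ωc + e) - T_a ωc) ≤ L * e ^ 2 := by
      calc e * (T_a (ωc + e) - T_a ωc) ≤ |e * (T_a (ωc + e) - T_a ωc)| := le_abs_self _
        _ = |e| * |T_a (ωc + e) - T_a ωc| := abs_mul _ _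
        _ ≤ |e| * (L * |e|) := mul_le_mul_of_nonneg_left (hLip e) (abs_nonneg e)
        _ = L * e ^ 2 := by rw [← sq_abs e]; ring
    have h3 : (1 - ν) * L < K_p * J := (div_lt_iff₀ hJ).mp hKp
    have h4 : 0 < e ^ 2 := by positivity
    have h5 := mul_le_mul_of_nonneg_left h2 hn.le
    have h6 := mul_lt_mul_of_pos_right h3 h4
    linarith
  · intro x e _ hde he t
    refine ⟨?_, he t⟩
    have he' : e = fun _ => 0 := funext he
    have h1 := hde t
    rw [he'] at h1
    have h2 := h1.unique (hasDerivAt_const t (0 : ℝ))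
    simp only [f, add_zero, sub_self, mul_zero, zero_sub, neg_eq_zero, mul_eq_zero] at h2
    rcases h2 with h2 | h2 | h2
    · exact absurd h2 (by positivity)
    · exact absurd h2 hKI.ne'
    · exact h2
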